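/- Let d ≥ 1, T ≥ 1, C0, C2, σ0, σ, γ > 0, λ ≥ 0, ε > 0, δ ∈ (0,1). Let G : ℝ^d → ℝ^d be measurable and let x̂, x̂' ∈ ℝ^d be deterministic with ‖x̂‖ ≤ C0 and ‖x̂'‖ ≤ C0. Define x_0 = x̂ + ξ_0 and x_0' = x̂' + ξ_0' with ξ_0, ξ_0' independent N(0, σ0² I_d), and x_{t+1} = Π_{C2}( x_t − γ (G(x_t) + λ x_t) ) + ξ_{t+1}, x_{t+1}' = Π_{C2}( x_t' − γ (G(x_t') + λ x_t') ) + ξ_{t+1}', with ξ_{t+1}, ξ_{t+1}' independent N(0, σ² I_d). If T ≥ ( log(1/δ) + log θ_ε(2C0/σ0) ) / log( 1 / θ_ε(2C2/σ) ), then the laws P, P' of x_T and x_T' satisfy both E_ε(P ‖ P') ≤ δ and E_ε(P' ‖ P) ≤ δ; i.e., the model-clipping unlearning algorithm satisfies (ε, δ)-unlearning. -/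

import Mathlib

open MeasureTheory Real Finset ENNReal

noncomputable section

abbrev E (d : ℕ) := EuclideanSpace ℝ (Fin d)

/-- Norm clipping operator `Π_C(x) = x ⬝ min(C/‖x‖, 1)`. -/
def clip {d : ℕ} (C : ℝ) (x : E d) : E d := (min (C / ‖x‖) 1) • x

/-- Gaussian measure `N(m, v I_d)` on `ℝ^d` (with variance `v`), via its density. -/
def gaussian (d : ℕ) (m : E d) (v : ℝ) : Measure (E d) :=
  volume.withDensity fun x =>
    ENNReal.ofReal ((2 * Real.pi * v) ^ (-(d : ℝ) / 2) * Real.exp (-‖x - m‖ ^ 2 / (2 * v)))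

/-- Rényi divergence of order `q`. -/
def renyiDiv {d : ℕ} (q : ℝ) (μ ν : Measure (E d)) : ℝ :=
  (q - 1)⁻¹ * Real.log (∫ x, ((μ.rnDeriv ν x).toReal) ^ q ∂ν)

/-- Hockey-stick divergence `E_ε(μ‖ν) = sup_A (μ(A) − e^ε ν(A))`. -/
def hockeyStick {d : ℕ} (ε : ℝ) (μ ν : Measure (E d)) : ℝ :=
  ⨆ A : {s : Set (E d) // MeasurableSet s},
    ((μ A.1).toReal - Real.exp ε * (ν A.1).toReal)

/-- `∞`-Wasserstein distance. -/
def wInfty {d : ℕ} (μ ν : Measure (E d)) : ℝ≥0∞ :=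
  ⨅ (ω : Measure (E d × E d)) (_ : ω.map Prod.fst = μ) (_ : ω.map Prod.snd = ν),
    essSup (fun p => edist p.1 p.2) ω

/-- Shifted Rényi divergence `D_q^{(z)}(μ‖ν)`. -/
def shiftedRenyi {d : ℕ} (q z : ℝ) (μ ν : Measure (E d)) : ℝ :=
  sInf ((fun μ' => renyiDiv q μ' ν) ''
    {μ' : Measure (E d) | IsProbabilityMeasure μ' ∧ wInfty μ' μ ≤ ENNReal.ofReal z})

/-- Law of the iterates `x_{t+1} = ψ_t(x_t) + ξ_t`, `ξ_t ~ N(0, v_t I_d)`, with `x_0 ~ μ0`. -/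
def lawSeq {d : ℕ} (ψ : ℕ → E d → E d) (v : ℕ → ℝ) (μ0 : Measure (E d)) : ℕ → Measure (E d)
  | 0 => μ0
  | t + 1 => (lawSeq ψ v μ0 t).bind fun x => gaussian d (ψ t x) (v t)

/-- Standard Gaussian tail function `Q`. -/
def gaussQ (t : ℝ) : ℝ := (Real.sqrt (2 * Real.pi))⁻¹ * ∫ u in Set.Ioi t, Real.exp (-u ^ 2 / 2)

/-- Amplification factor `θ_ε(r) = Q(ε/r − r/2) − e^ε Q(ε/r + r/2)`. -/
def theta (ε r : ℝ) : ℝ := gaussQ (ε / r - r / 2) - Real.exp ε * gaussQ (ε / r + r / 2)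

/-! ### Likelihood-ratio sets maximise the hockey-stick functional -/

lemma withDensity_ofReal_real_apply {X : Type*} [MeasurableSpace X] {κ : Measure X} {p : X → ℝ}
    (hp : Integrable p κ) (hp0 : ∀ x, 0 ≤ p x) {A : Set X} (hA : MeasurableSet A) :
    (κ.withDensity fun x => ENNReal.ofReal (p x)).real A = ∫ x in A, p x ∂κ := by
  rw [Measure.real, withDensity_apply _ hA,
    integral_eq_lintegral_of_nonneg_ae (ae_of_all _ hp0) hp.aestronglyMeasurable.restrict]

lemma withDensity_sub_le_of_likelihood_ratio {X : Type*} [MeasurableSpace X] {κ : Measure X}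
    {p q : X → ℝ} (hpm : Measurable p) (hqm : Measurable q) (hp : Integrable p κ)
    (hq : Integrable q κ) (hp0 : ∀ x, 0 ≤ p x) (hq0 : ∀ x, 0 ≤ q x) (c : ℝ)
    {A : Set X} (hA : MeasurableSet A) :
    (κ.withDensity fun x => ENNReal.ofReal (p x)).real A
        - c * (κ.withDensity fun x => ENNReal.ofReal (q x)).real A
      ≤ (κ.withDensity fun x => ENNReal.ofReal (p x)).real {x | c * q x ≤ p x}
        - c * (κ.withDensity fun x => ENNReal.ofReal (q x)).real {x | c * q x ≤ p x} := by
  have hH : MeasurableSet {x | c * q x ≤ p x} := measurableSet_le (hqm.const_mul c) hpm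
  have key : ∀ B : Set X, MeasurableSet B →
      (κ.withDensity fun x => ENNReal.ofReal (p x)).real B
        - c * (κ.withDensity fun x => ENNReal.ofReal (q x)).real B
      = ∫ x in B, (p x - c * q x) ∂κ := by
    intro B hB
    rw [withDensity_ofReal_real_apply hp hp0 hB, withDensity_ofReal_real_apply hq hq0 hB,
      integral_sub hp.integrableOn (hq.const_mul c).integrableOn, integral_const_mul]
  rw [key A hA, key _ hH]
  have h := setIntegral_le_nonneg hA (hpm.sub (hqm.const_mul c)).stronglyMeasurable
    (hp.sub (hq.const_mul c))
  simpa only [Pi.sub_apply, sub_nonneg] using h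

/-! ### The Gaussian tail function and `theta` -/

lemma gaussQ_eq_gaussianReal (t : ℝ) :
    gaussQ t = (ProbabilityTheory.gaussianReal 0 1).real (Set.Ioi t) := by
  rw [Measure.real, ProbabilityTheory.gaussianReal_apply_eq_integral _ one_ne_zero,
    ENNReal.toReal_ofReal (integral_nonneg fun x =>
      ProbabilityTheory.gaussianPDFReal_nonneg _ _ _), gaussQ, ← integral_const_mul]
  simp [ProbabilityTheory.gaussianPDFReal]

lemma gaussianReal_real_Ioi (m : ℝ) {s : ℝ} (hs : 0 < s) (c : ℝ) :
    (ProbabilityTheory.gaussianReal m (.mk (s ^ 2) (sq_nonneg s))).real (Set.Ioi c)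
      = gaussQ ((c - m) / s) := by
  have h1 : ProbabilityTheory.gaussianReal m (.mk (s ^ 2) (sq_nonneg s))
      = ((ProbabilityTheory.gaussianReal 0 1).map (fun x => s * x)).map (fun x => x + m) := by
    rw [ProbabilityTheory.gaussianReal_map_const_mul, ProbabilityTheory.gaussianReal_map_add_const]
    simp
  rw [h1, gaussQ_eq_gaussianReal, Measure.real, Measure.real,
    Measure.map_apply (by fun_prop) measurableSet_Ioi,
    Measure.map_apply (by fun_prop) (measurableSet_Ioi.preimage (by fun_prop))]
  congr 2
  ext x
  simp only [Set.mem_preimage, Set.mem_Ioi]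
  rw [div_lt_iff₀ hs, sub_lt_iff_lt_add, mul_comm]

lemma gaussQ_nonneg (t : ℝ) : 0 ≤ gaussQ t := by
  rw [gaussQ_eq_gaussianReal]; exact measureReal_nonneg

lemma gaussQ_le_one (t : ℝ) : gaussQ t ≤ 1 := by
  rw [gaussQ_eq_gaussianReal]; exact measureReal_le_one

lemma gaussQ_pos (t : ℝ) : 0 < gaussQ t := by
  rw [gaussQ_eq_gaussianReal, Measure.real, ENNReal.toReal_pos_iff]
  refine ⟨?_, measure_lt_top _ _⟩
  rw [pos_iff_ne_zero]
  intro h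
  have h2 := ProbabilityTheory.gaussianReal_absolutelyContinuous' 0 one_ne_zero h
  simp at h2

lemma theta_lt_one (ε r : ℝ) : theta ε r < 1 := by
  have := mul_pos (Real.exp_pos ε) (gaussQ_pos (ε / r + r / 2))
  have := gaussQ_le_one (ε / r - r / 2)
  unfold theta; linarith

lemma gaussianReal_real_Ioi_one (m t : ℝ) :
    (ProbabilityTheory.gaussianReal m 1).real (Set.Ioi t) = gaussQ (t - m) := by
  have h := gaussianReal_real_Ioi m one_pos t
  have h1 : NNReal.mk ((1 : ℝ) ^ 2) (sq_nonneg 1) = 1 := by ext; simp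
  rwa [div_one, h1] at h

lemma gaussianReal_sub_le_theta (ε : ℝ) {R : ℝ} (hR : 0 < R) {A : Set ℝ} (hA : MeasurableSet A) :
    (ProbabilityTheory.gaussianReal R 1).real A
      - Real.exp ε * (ProbabilityTheory.gaussianReal 0 1).real A ≤ theta ε R := by
  have h := withDensity_sub_le_of_likelihood_ratio (κ := volume)
    (ProbabilityTheory.measurable_gaussianPDFReal R 1)
    (ProbabilityTheory.measurable_gaussianPDFReal 0 1)
    (ProbabilityTheory.integrable_gaussianPDFReal R 1)
    (ProbabilityTheory.integrable_gaussianPDFReal 0 1)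
    (ProbabilityTheory.gaussianPDFReal_nonneg R 1)
    (ProbabilityTheory.gaussianPDFReal_nonneg 0 1) (Real.exp ε) hA
  have hset : {x | Real.exp ε * ProbabilityTheory.gaussianPDFReal 0 1 x
      ≤ ProbabilityTheory.gaussianPDFReal R 1 x} = Set.Ici (ε / R + R / 2) := by
    ext x
    have hc : 0 < (√(2 * π * ((1 : NNReal) : ℝ)))⁻¹ := by
      simp only [NNReal.coe_one]; positivity
    simp only [ProbabilityTheory.gaussianPDFReal, Set.mem_ofPred_eq, Set.mem_Ici]
    rw [mul_left_comm, mul_le_mul_iff_right₀ hc, ← Real.exp_add, Real.exp_le_exp]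
    simp only [NNReal.coe_one]
    have : ε / R + R / 2 = (ε + R ^ 2 / 2) / R := by field_simp
    rw [this, div_le_iff₀ hR]
    constructor <;> intro h <;> nlinarith
  have hwd : ∀ m, (volume.withDensity fun x =>
      ENNReal.ofReal (ProbabilityTheory.gaussianPDFReal m 1 x))
      = ProbabilityTheory.gaussianReal m 1 := fun m =>
    (ProbabilityTheory.gaussianReal_of_var_ne_zero m one_ne_zero).symm
  have hatom : ∀ m, NullSingletonClass (ProbabilityTheory.gaussianReal m 1) := fun m =>
    ProbabilityTheory.nullSingletonClass_gaussianReal one_ne_zero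
  rw [hset, hwd, hwd, measureReal_congr Ioi_ae_eq_Ici.symm, measureReal_congr Ioi_ae_eq_Ici.symm,
    gaussianReal_real_Ioi_one, gaussianReal_real_Ioi_one, sub_zero] at h
  refine h.trans (le_of_eq ?_)
  rw [theta]
  congr 2
  ring

lemma theta_nonneg (ε : ℝ) {R : ℝ} (hR : 0 < R) : 0 ≤ theta ε R := by
  simpa using gaussianReal_sub_le_theta ε hR MeasurableSet.empty

lemma gaussQ_sub_le_theta_of_le {ε r R : ℝ} (t : ℝ) (hR : 0 < R) (hrR : r ≤ R) :
    gaussQ (t - r) - Real.exp ε * gaussQ t ≤ theta ε R := by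
  have h := gaussianReal_sub_le_theta ε hR (measurableSet_Ioi (a := t))
  rw [gaussianReal_real_Ioi_one, gaussianReal_real_Ioi_one, sub_zero] at h
  have : gaussQ (t - r) ≤ gaussQ (t - R) := by
    rw [gaussQ_eq_gaussianReal, gaussQ_eq_gaussianReal]
    exact measureReal_mono (Set.Ioi_subset_Ioi (by linarith))
  linarith

/-! ### Gaussian measures on Euclidean space -/

/-- Density of `N(m, v I_d)` with respect to Lebesgue measure. -/
def gaussianDensity (d : ℕ) (v : ℝ) (m x : E d) : ℝ :=
  (2 * Real.pi * v) ^ (-(d : ℝ) / 2) * Real.exp (-‖x - m‖ ^ 2 / (2 * v))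

lemma gaussianDensity_nonneg {d : ℕ} {v : ℝ} (hv : 0 < v) (m x : E d) :
    0 ≤ gaussianDensity d v m x := by
  unfold gaussianDensity; positivity

lemma measurable_gaussianDensity (d : ℕ) (v : ℝ) :
    Measurable (Function.uncurry (gaussianDensity d v)) := by
  unfold gaussianDensity Function.uncurry; fun_prop

lemma integrable_exp_neg_sq_norm_sub {d : ℕ} {v : ℝ} (hv : 0 < v) (m : E d) :
    Integrable (fun x : E d => Real.exp (-‖x - m‖ ^ 2 / (2 * v))) := by
  have h := (GaussianFourier.integrable_cexp_neg_mul_sq_norm_add (V := E d)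
    (b := (((2 * v)⁻¹ : ℝ) : ℂ)) (by rw [Complex.ofReal_re]; positivity) 0 0).norm
  refine (Integrable.comp_sub_right (g := m) h).congr (ae_of_all _ fun x => ?_)
  simp only [Complex.norm_exp]
  congr 1
  simp only [zero_mul, add_zero, ← Complex.ofReal_neg, ← Complex.ofReal_pow, ← Complex.ofReal_mul,
    Complex.ofReal_re]
  field_simp

lemma integrable_gaussianDensity {d : ℕ} {v : ℝ} (hv : 0 < v) (m : E d) :
    Integrable (gaussianDensity d v m) :=
  (integrable_exp_neg_sq_norm_sub hv m).const_mul _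

lemma integral_gaussianDensity {d : ℕ} {v : ℝ} (hv : 0 < v) (m : E d) :
    ∫ x, gaussianDensity d v m x = 1 := by
  unfold gaussianDensity
  rw [integral_const_mul,
    integral_sub_right_eq_self (fun x : E d => Real.exp (-‖x‖ ^ 2 / (2 * v))) m]
  have h := GaussianFourier.integral_rexp_neg_mul_sq_norm (V := E d) (b := (2 * v)⁻¹)
    (by positivity)
  have h2 : ∀ x : E d, -‖x‖ ^ 2 / (2 * v) = -(2 * v)⁻¹ * ‖x‖ ^ 2 := fun x => by field_simp
  simp_rw [h2]
  rw [h, finrank_euclideanSpace_fin, div_inv_eq_mul, show π * (2 * v) = 2 * π * v by ring,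
    ← Real.rpow_add (by positivity)]
  rw [show -(d : ℝ) / 2 + d / 2 = 0 by ring, Real.rpow_zero]

lemma isProbabilityMeasure_gaussian {d : ℕ} {v : ℝ} (hv : 0 < v) (m : E d) :
    IsProbabilityMeasure (gaussian d m v) := by
  constructor
  have h := ofReal_integral_eq_lintegral_ofReal (integrable_gaussianDensity hv m)
    (ae_of_all _ (gaussianDensity_nonneg hv m))
  rw [integral_gaussianDensity hv m] at h
  rw [gaussian, withDensity_apply _ MeasurableSet.univ, Measure.restrict_univ]
  simpa [gaussianDensity] using h.symm

lemma map_inner_gaussian {d : ℕ} {s : ℝ} (hs : 0 < s) (m : E d) {w : E d} (hw : ‖w‖ = 1) :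
    (gaussian d m (s ^ 2)).map (fun x => inner ℝ w x)
      = ProbabilityTheory.gaussianReal (inner ℝ w m) (.mk (s ^ 2) (sq_nonneg s)) := by
  have hv : 0 < s ^ 2 := by positivity
  have := isProbabilityMeasure_gaussian hv m
  have hmeas : Measurable (fun x : E d => (inner ℝ w x : ℝ)) := by fun_prop
  have := Measure.isProbabilityMeasure_map (μ := gaussian d m (s ^ 2)) hmeas.aemeasurable
  refine Measure.ext_of_charFun ?_
  ext t
  rw [ProbabilityTheory.charFun_gaussianReal, charFun_apply_real,
    integral_map hmeas.aemeasurable (by fun_prop)]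
  change ∫ x, _ ∂(volume.withDensity fun x => ENNReal.ofReal (gaussianDensity d (s ^ 2) m x)) = _
  rw [integral_withDensity_eq_integral_toReal_smul
    ((measurable_gaussianDensity d (s ^ 2)).of_uncurry_left).ennreal_ofReal
    (ae_of_all _ fun _ => ENNReal.ofReal_lt_top)]
  simp_rw [ENNReal.toReal_ofReal (gaussianDensity_nonneg hv m _)]
  rw [← integral_add_right_eq_self _ m]
  have hint : ∀ x : E d, gaussianDensity d (s ^ 2) m (x + m) •
      Complex.exp ((t : ℂ) * ((inner ℝ w (x + m) : ℝ) : ℂ) * Complex.I)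
      = (((2 * π * s ^ 2) ^ (-(d : ℝ) / 2) : ℝ) : ℂ) *
        Complex.exp ((t : ℂ) * ((inner ℝ w m : ℝ) : ℂ) * Complex.I) *
        Complex.exp (-(((2 * s ^ 2)⁻¹ : ℝ) : ℂ) * (‖x‖ : ℂ) ^ 2
          + (t * Complex.I) * ((inner ℝ w x : ℝ) : ℂ)) := by
    intro x
    rw [gaussianDensity]
    generalize (2 * π * s ^ 2) ^ (-(d : ℝ) / 2) = K
    rw [Complex.real_smul, Complex.ofReal_mul, mul_assoc, mul_assoc (K : ℂ) (Complex.exp _),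
      Complex.ofReal_exp, ← Complex.exp_add, ← Complex.exp_add, add_sub_cancel_right, inner_add_right]
    congr 2
    push_cast
    field_simp
    ring
  simp_rw [hint]
  rw [integral_const_mul, GaussianFourier.integral_cexp_neg_mul_sq_norm_add
    (by rw [Complex.ofReal_re]; positivity), finrank_euclideanSpace_fin, hw]
  have hconst : (((2 * π * s ^ 2) ^ (-(d : ℝ) / 2) : ℝ) : ℂ)
      * ((π : ℂ) / (((2 * s ^ 2)⁻¹ : ℝ) : ℂ)) ^ ((d : ℂ) / 2) = 1 := by
    have h1 : (π : ℂ) / (((2 * s ^ 2)⁻¹ : ℝ) : ℂ) = ((2 * π * s ^ 2 : ℝ) : ℂ) := by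
      push_cast; field_simp
    have h2 : (d : ℂ) / 2 = (((d : ℝ) / 2 : ℝ) : ℂ) := by push_cast; rfl
    rw [h1, h2, ← Complex.ofReal_cpow (by positivity), ← Complex.ofReal_mul,
      ← Real.rpow_add (by positivity), show -(d : ℝ) / 2 + d / 2 = 0 by ring, Real.rpow_zero,
      Complex.ofReal_one]
  rw [mul_assoc, mul_left_comm, ← mul_assoc, ← mul_assoc, mul_assoc (Complex.exp _), hconst, mul_one,
    ← Complex.exp_add]
  congr 1
  have hs' : (s : ℂ) ≠ 0 := by exact_mod_cast hs.ne'
  simp only [NNReal.coe_mk]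
  push_cast
  field_simp
  linear_combination (4 * (t : ℂ) ^ 2 * (s : ℂ) ^ 2) * Complex.I_sq

lemma gaussian_real_halfspace {d : ℕ} {s : ℝ} (hs : 0 < s) (m : E d) {w : E d} (hw : ‖w‖ = 1)
    (c : ℝ) : (gaussian d m (s ^ 2)).real {x | c ≤ inner ℝ w x}
      = gaussQ ((c - inner ℝ w m) / s) := by
  have hne : (NNReal.mk (s ^ 2) (sq_nonneg s)) ≠ 0 := by
    intro h0
    have := congrArg NNReal.toReal h0
    simp at this
    exact hs.ne' this
  have := ProbabilityTheory.nullSingletonClass_gaussianReal (μ := inner ℝ w m) hne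
  rw [← gaussianReal_real_Ioi _ hs, measureReal_congr Ioi_ae_eq_Ici, ← map_inner_gaussian hs m hw,
    Measure.real, Measure.real, Measure.map_apply (by fun_prop) measurableSet_Ici]
  rfl

lemma gaussian_sub_le_theta {d : ℕ} {s ε R : ℝ} (hs : 0 < s) (hε : 0 ≤ ε) (hR : 0 < R)
    {m m' : E d} (hmm : ‖m - m'‖ / s ≤ R) {A : Set (E d)} (hA : MeasurableSet A) :
    (gaussian d m (s ^ 2)).real A - Real.exp ε * (gaussian d m' (s ^ 2)).real A ≤ theta ε R := by
  have hv : 0 < s ^ 2 := by positivity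
  have he : 1 ≤ Real.exp ε := Real.one_le_exp hε
  by_cases hm : m = m'
  · subst hm
    have := mul_le_mul_of_nonneg_right he
      (measureReal_nonneg (μ := gaussian d m (s ^ 2)) (s := A))
    have := theta_nonneg ε hR
    linarith
  have hn : 0 < ‖m - m'‖ := norm_pos_iff.2 (sub_ne_zero.2 hm)
  set w : E d := ‖m - m'‖⁻¹ • (m - m') with hwdef
  have hw : ‖w‖ = 1 := by rw [hwdef, norm_smul, norm_inv, norm_norm, inv_mul_cancel₀ hn.ne']
  have hwn : ∀ x, inner ℝ (m - m') x = ‖m - m'‖ * (inner ℝ w x : ℝ) := fun x => by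
    rw [hwdef, inner_smul_left]; simp; field_simp
  have hwm : (inner ℝ w m : ℝ) = inner ℝ w m' + ‖m - m'‖ := by
    have h := hwn (m - m')
    rw [real_inner_self_eq_norm_sq, inner_sub_right, sq] at h
    have := mul_left_cancel₀ hn.ne' h
    linarith
  set c : ℝ := s ^ 2 * ε / ‖m - m'‖ + ‖m - m'‖ / 2 + inner ℝ w m' with hc
  have hset : {x | Real.exp ε * gaussianDensity d (s ^ 2) m' x ≤ gaussianDensity d (s ^ 2) m x}
      = {x | c ≤ inner ℝ w x} := by
    ext x
    have hK : 0 < (2 * π * s ^ 2) ^ (-(d : ℝ) / 2) := by positivity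
    simp only [gaussianDensity, Set.mem_ofPred_eq]
    rw [mul_left_comm, mul_le_mul_iff_right₀ hK, ← Real.exp_add, Real.exp_le_exp]
    have h1 : ‖x - m‖ ^ 2 = ‖x - m'‖ ^ 2 - 2 * (‖m - m'‖ * (inner ℝ w x - inner ℝ w m'))
        + ‖m - m'‖ ^ 2 := by
      have h2 : x - m = (x - m') - (m - m') := by abel
      rw [h2, norm_sub_sq_real, real_inner_comm, hwn, inner_sub_right]
    have h3 : c = (s ^ 2 * ε + ‖m - m'‖ ^ 2 / 2 + ‖m - m'‖ * inner ℝ w m') / ‖m - m'‖ := by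
      rw [hc]; field_simp
    rw [h3, div_le_iff₀ hn, h1]
    have h4 : ε + -‖x - m'‖ ^ 2 / (2 * s ^ 2) = (2 * s ^ 2 * ε - ‖x - m'‖ ^ 2) / (2 * s ^ 2) := by
      field_simp; ring
    rw [h4, div_le_div_iff_of_pos_right (by positivity)]
    constructor <;> intro h <;> linarith
  have h := withDensity_sub_le_of_likelihood_ratio (κ := volume)
    ((measurable_gaussianDensity d (s ^ 2)).of_uncurry_left (x := m))
    ((measurable_gaussianDensity d (s ^ 2)).of_uncurry_left (x := m'))
    (integrable_gaussianDensity hv m) (integrable_gaussianDensity hv m')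
    (gaussianDensity_nonneg hv m) (gaussianDensity_nonneg hv m') (Real.exp ε) hA
  rw [hset] at h
  refine h.trans ?_
  change (gaussian d m (s ^ 2)).real _ - _ * (gaussian d m' (s ^ 2)).real _ ≤ _
  rw [gaussian_real_halfspace hs m hw, gaussian_real_halfspace hs m' hw]
  have h5 : (c - inner ℝ w m) / s = (c - inner ℝ w m') / s - ‖m - m'‖ / s := by
    rw [hwm]; ring
  rw [h5]
  exact gaussQ_sub_le_theta_of_le _ hR hmm

/-! ### Contraction of the hockey-stick divergence under Markov kernels -/

lemma integral_sub_le_of_measure_sub_le {X : Type*} [MeasurableSpace X] {μ ν : Measure X}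
    [IsFiniteMeasure μ] [IsFiniteMeasure ν] {c D : ℝ} (hc : 0 ≤ c)
    (h : ∀ A, MeasurableSet A → μ.real A - c * ν.real A ≤ D) {w : ℝ} {g : X → ℝ}
    (hg : Measurable g) (hg0 : ∀ x, 0 ≤ g x) (hgw : ∀ x, g x ≤ w) (hw : 0 ≤ w) :
    ∫ x, g x ∂μ - c * ∫ x, g x ∂ν ≤ w * D := by
  set ν' : Measure X := ENNReal.ofReal c • ν with hν'
  have : IsFiniteMeasure ν' := Measure.smul_finite ν ENNReal.ofReal_ne_top
  have hν'real : ∀ A, ν'.real A = c * ν.real A := fun A => by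
    rw [hν', measureReal_ennreal_smul_apply, ENNReal.toReal_ofReal hc]
  have hν'int : ∫ x, g x ∂ν' = c * ∫ x, g x ∂ν := by
    rw [hν', integral_smul_measure, ENNReal.toReal_ofReal hc, smul_eq_mul]
  have hint : ∀ ρ : Measure X, IsFiniteMeasure ρ → Integrable g ρ := fun ρ _ =>
    Integrable.of_bound hg.aestronglyMeasurable w
      (ae_of_all _ fun x => by rw [Real.norm_of_nonneg (hg0 x)]; exact hgw x)
  obtain ⟨s, hs, hpos, hneg⟩ := hahn_decomposition μ ν'
  have hcompl : ∫ x in sᶜ, g x ∂μ ≤ ∫ x in sᶜ, g x ∂ν' := by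
    refine integral_mono_measure ?_ (ae_of_all _ hg0) (hint _ inferInstance)
    refine Measure.le_iff.2 fun t ht => ?_
    rw [Measure.restrict_apply ht, Measure.restrict_apply ht]
    exact hneg _ (ht.inter hs.compl) Set.inter_subset_right
  have hin : ∫ x in s, (w - g x) ∂ν' ≤ ∫ x in s, (w - g x) ∂μ := by
    refine integral_mono_measure ?_ (ae_of_all _ fun x => sub_nonneg.2 (hgw x))
      ((integrable_const w).sub (hint _ inferInstance))
    refine Measure.le_iff.2 fun t ht => ?_
    rw [Measure.restrict_apply ht, Measure.restrict_apply ht]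
    exact hpos _ (ht.inter hs) Set.inter_subset_right
  rw [integral_sub (integrable_const w) (hint _ inferInstance),
    integral_sub (integrable_const w) (hint _ inferInstance), setIntegral_const,
    setIntegral_const, smul_eq_mul, smul_eq_mul, hν'real] at hin
  rw [← hν'int, ← integral_add_compl hs (hint μ inferInstance),
    ← integral_add_compl hs (hint ν' inferInstance)]
  have := mul_le_mul_of_nonneg_left (h s hs) hw
  linarith

lemma bind_sub_le_of_measure_sub_le {X Y : Type*} [MeasurableSpace X] [MeasurableSpace Y]
    {μ ν : Measure X} [IsProbabilityMeasure μ] [IsProbabilityMeasure ν] {K : X → Measure Y}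
    (hK : Measurable K) (hKp : ∀ x, IsProbabilityMeasure (K x)) {c D θ : ℝ} (hc : 1 ≤ c)
    (hD : D ≤ 1) (hKθ : ∀ x x' A, MeasurableSet A → (K x).real A - c * (K x').real A ≤ θ)
    (hθ : 0 ≤ θ) (h : ∀ A, MeasurableSet A → μ.real A - c * ν.real A ≤ D)
    {A : Set Y} (hA : MeasurableSet A) :
    (μ.bind K).real A - c * (ν.bind K).real A ≤ θ * D := by
  have hKA : Measurable fun x => K x A := (Measure.measurable_coe hA).comp hK
  set f : X → ℝ := fun x => (K x).real A with hf
  have hfm : Measurable f := hKA.ennreal_toReal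
  have hbind : ∀ ρ : Measure X, (ρ.bind K).real A = ∫ x, f x ∂ρ := fun ρ => by
    rw [Measure.real, Measure.bind_apply hA hK.aemeasurable, ← integral_toReal hKA.aemeasurable
      (ae_of_all _ fun x => measure_lt_top _ _)]
    rfl
  have : Nonempty X := nonempty_of_isProbabilityMeasure μ
  have hf0 : ∀ x, 0 ≤ f x := fun x => measureReal_nonneg
  have hf1 : ∀ x, f x ≤ 1 := fun x => measureReal_le_one
  have hbdd : BddBelow (Set.range f) := ⟨0, by rintro _ ⟨x, rfl⟩; exact hf0 x⟩
  set i : ℝ := ⨅ x, f x with hi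
  have hi0 : 0 ≤ i := le_ciInf hf0
  have hfi : ∀ x, i ≤ f x := fun x => ciInf_le hbdd x
  have hsup : ∀ x, f x - i ≤ (c - 1) * i + θ := by
    intro x
    have : (f x - θ) / c ≤ i := le_ciInf fun x' => by
      rw [div_le_iff₀ (by linarith)]
      linarith [hKθ x x' A hA, mul_comm c (f x')]
    rw [div_le_iff₀ (by linarith)] at this
    linarith
  have hint : ∀ ρ : Measure X, IsProbabilityMeasure ρ → Integrable f ρ := fun ρ _ =>
    Integrable.of_bound hfm.aestronglyMeasurable 1
      (ae_of_all _ fun x => by rw [Real.norm_of_nonneg (hf0 x)]; exact hf1 x)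
  have hw : 0 ≤ (c - 1) * i := mul_nonneg (by linarith) hi0
  have key := integral_sub_le_of_measure_sub_le (by linarith) h (hfm.sub_const i)
    (fun x => sub_nonneg.2 (hfi x)) hsup (by linarith)
  rw [integral_sub (hint μ inferInstance) (integrable_const i),
    integral_sub (hint ν inferInstance) (integrable_const i)] at key
  simp only [integral_const, probReal_univ, one_smul] at key
  rw [hbind, hbind]
  nlinarith [mul_le_mul_of_nonneg_left hD hw]

/-! ### The clipped iteration -/

lemma norm_clip_le {d : ℕ} {C : ℝ} (hC : 0 ≤ C) (x : E d) : ‖clip C x‖ ≤ C := by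
  rw [clip, norm_smul, Real.norm_of_nonneg (le_min (by positivity) zero_le_one)]
  rcases eq_or_ne x 0 with rfl | hx
  · simpa using hC
  calc _ ≤ C / ‖x‖ * ‖x‖ := by gcongr; exact min_le_left _ _
    _ = C := div_mul_cancel₀ _ (norm_ne_zero_iff.2 hx)

lemma measurable_clip {d : ℕ} (C : ℝ) : Measurable (clip C : E d → E d) := by
  unfold clip; fun_prop

lemma measurable_gaussian {d : ℕ} (v : ℝ) : Measurable fun m : E d => gaussian d m v := by
  refine Measure.measurable_of_measurable_coe _ fun A hA => ?_
  simp only [gaussian, withDensity_apply _ hA]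
  exact Measurable.lintegral_prod_right' (ν := volume.restrict A)
    (measurable_gaussianDensity d v).ennreal_ofReal

lemma isProbabilityMeasure_lawSeq {d : ℕ} {ψ : ℕ → E d → E d} {v : ℕ → ℝ} {μ0 : Measure (E d)}
    [IsProbabilityMeasure μ0] (hψ : ∀ t, Measurable (ψ t)) (hv : ∀ t, 0 < v t) (t : ℕ) :
    IsProbabilityMeasure (lawSeq ψ v μ0 t) := by
  induction t with
  | zero => assumption
  | succ t ih =>
    exact isProbabilityMeasure_bind ((measurable_gaussian _).comp (hψ t)).aemeasurable
      (ae_of_all _ fun x => isProbabilityMeasure_gaussian (hv t) _)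

lemma lawSeq_sub_le {d : ℕ} {ψ : ℕ → E d → E d} (hψ : ∀ t, Measurable (ψ t)) {C s ε D : ℝ}
    (hC : 0 < C) (hs : 0 < s) (hε : 0 ≤ ε) (hψC : ∀ t x, ‖ψ t x‖ ≤ C) {μ ν : Measure (E d)}
    [IsProbabilityMeasure μ] [IsProbabilityMeasure ν] (hD0 : 0 ≤ D) (hD1 : D ≤ 1)
    (h : ∀ A, MeasurableSet A → μ.real A - Real.exp ε * ν.real A ≤ D) (t : ℕ) :
    ∀ A, MeasurableSet A → (lawSeq ψ (fun _ => s ^ 2) μ t).real A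
      - Real.exp ε * (lawSeq ψ (fun _ => s ^ 2) ν t).real A ≤ theta ε (2 * C / s) ^ t * D := by
  have hv : 0 < s ^ 2 := by positivity
  have hR : 0 < 2 * C / s := by positivity
  have hθ := theta_nonneg ε hR
  induction t with
  | zero => simpa [lawSeq] using h
  | succ t ih =>
    intro A hA
    have := isProbabilityMeasure_lawSeq (μ0 := μ) hψ (fun _ => hv) t
    have := isProbabilityMeasure_lawSeq (μ0 := ν) hψ (fun _ => hv) t
    rw [pow_succ' (theta _ _), mul_assoc]
    refine bind_sub_le_of_measure_sub_le ((measurable_gaussian _).comp (hψ t))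
      (fun x => isProbabilityMeasure_gaussian hv _) (Real.one_le_exp hε)
      (mul_le_one₀ (pow_le_one₀ hθ (theta_lt_one _ _).le) hD0 hD1)
      (fun x x' B hB => gaussian_sub_le_theta hs hε hR ?_ hB) hθ ih hA
    gcongr
    linarith [norm_sub_le (ψ t x) (ψ t x'), hψC t x, hψC t x']

lemma pow_mul_le_of_log_div_le {a b δ : ℝ} {T : ℕ} (hT : 1 ≤ T) (ha0 : 0 ≤ a) (ha1 : a < 1)
    (hb : 0 ≤ b) (hδ : 0 < δ)
    (h : (Real.log (1 / δ) + Real.log b) / Real.log (1 / a) ≤ T) : a ^ T * b ≤ δ := by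
  rcases ha0.eq_or_lt with rfl | ha
  · rw [zero_pow (by omega), zero_mul]; exact hδ.le
  rcases hb.eq_or_lt with rfl | hb
  · rw [mul_zero]; exact hδ.le
  rw [div_le_iff₀ (Real.log_pos (by rw [lt_div_iff₀ ha]; linarith)), one_div, one_div,
    Real.log_inv, Real.log_inv] at h
  rw [← Real.log_le_log_iff (by positivity) hδ, Real.log_mul (by positivity) hb.ne', Real.log_pow]
  linarith

lemma hockeyStick_lawSeq_clip_le {d T : ℕ} (hT : 1 ≤ T) {C0 C2 σ0 σ ε δ : ℝ} (hC0 : 0 < C0)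
    (hC2 : 0 < C2) (hσ0 : 0 < σ0) (hσ : 0 < σ) (hε : 0 ≤ ε) (hδ : 0 < δ) {F : E d → E d}
    (hF : Measurable F) {y y' : E d} (hy : ‖y‖ ≤ C0) (hy' : ‖y'‖ ≤ C0)
    (hTlarge : (Real.log (1 / δ) + Real.log (theta ε (2 * C0 / σ0))) /
      Real.log (1 / theta ε (2 * C2 / σ)) ≤ T) :
    hockeyStick ε
      (lawSeq (fun _ x => clip C2 (F x)) (fun _ => σ ^ 2) (gaussian d y (σ0 ^ 2)) T)
      (lawSeq (fun _ x => clip C2 (F x)) (fun _ => σ ^ 2) (gaussian d y' (σ0 ^ 2)) T) ≤ δ := by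
  have hv0 : 0 < σ0 ^ 2 := by positivity
  have := isProbabilityMeasure_gaussian hv0 y
  have := isProbabilityMeasure_gaussian hv0 y'
  have hR0 : 0 < 2 * C0 / σ0 := by positivity
  have hR : 0 < 2 * C2 / σ := by positivity
  have : Nonempty {s : Set (E d) // MeasurableSet s} := ⟨⟨∅, MeasurableSet.empty⟩⟩
  refine ciSup_le fun A => ?_
  refine (lawSeq_sub_le (fun _ => (measurable_clip C2).comp hF) hC2 hσ hε
    (fun _ x => norm_clip_le hC2.le _) (theta_nonneg ε hR0) (theta_lt_one _ _).le
    (fun B hB => gaussian_sub_le_theta hσ0 hε hR0 ?_ hB) T A.1 A.2).trans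
    (pow_mul_le_of_log_div_le hT (theta_nonneg ε hR) (theta_lt_one _ _) (theta_nonneg ε hR0) hδ
      hTlarge)
  gcongr
  linarith [norm_sub_le y y']

/-- Theorem 2 (model clipping): `(ε,δ)`-unlearning provided
`T ≥ (log(1/δ) + log θ_ε(2C0/σ0)) / log(1/θ_ε(2C2/σ))`. -/
theorem stmt6 {d : ℕ} (hd : 1 ≤ d) (T : ℕ) (hT : 1 ≤ T)
    (C0 C2 σ0 σ γ : ℝ) (hC0 : 0 < C0) (hC2 : 0 < C2) (hσ0 : 0 < σ0) (hσ : 0 < σ)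
    (hγ : 0 < γ) (lam : ℝ) (hlam : 0 ≤ lam)
    (ε : ℝ) (hε : 0 < ε) (δ : ℝ) (hδ : δ ∈ Set.Ioo (0 : ℝ) 1)
    (G : E d → E d) (hG : Measurable G)
    (xh xh' : E d) (hxh : ‖xh‖ ≤ C0) (hxh' : ‖xh'‖ ≤ C0)
    (hTlarge : (T : ℝ) ≥ (Real.log (1 / δ) + Real.log (theta ε (2 * C0 / σ0))) /
      Real.log (1 / theta ε (2 * C2 / σ))) :
    hockeyStick ε
        (lawSeq (fun _ x => clip C2 (x - γ • (G x + lam • x))) (fun _ => σ ^ 2)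
          (gaussian d xh (σ0 ^ 2)) T)
        (lawSeq (fun _ x => clip C2 (x - γ • (G x + lam • x))) (fun _ => σ ^ 2)
          (gaussian d xh' (σ0 ^ 2)) T) ≤ δ
      ∧
    hockeyStick ε
        (lawSeq (fun _ x => clip C2 (x - γ • (G x + lam • x))) (fun _ => σ ^ 2)
          (gaussian d xh' (σ0 ^ 2)) T)
        (lawSeq (fun _ x => clip C2 (x - γ • (G x + lam • x))) (fun _ => σ ^ 2)
          (gaussian d xh (σ0 ^ 2)) T) ≤ δ := by
  have hF : Measurable fun x => x - γ • (G x + lam • x) := by fun_prop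
  exact ⟨hockeyStick_lawSeq_clip_le hT hC0 hC2 hσ0 hσ hε.le hδ.1 hF hxh hxh' hTlarge,
    hockeyStick_lawSeq_clip_le hT hC0 hC2 hσ0 hσ hε.le hδ.1 hF hxh' hxh hTlarge⟩
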